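/- arXiv:2201.13323 — 3 statements merged into one kernel-verified Lean document; each statement's English description precedes it below -/
import Mathlib

section
/- Let N, n be positive integers and let Z = {z_1, ..., z_N} be a set of N points in ℝ^n. For every ε ∈ (0,1) and every positive integer μ with μ ≥ 8 ln N / (ε² − ε³), there exists a map G : ℝ^n → ℝ^μ such that for all z_i, z_j ∈ Z, (1 − ε)·‖z_i − z_j‖² ≤ ‖G(z_i) − G(z_j)‖² ≤ (1 + ε)·‖z_i − z_j‖², where ‖·‖ denotes the Euclidean norm. -/
open MeasureTheory ProbabilityTheory in
lemma jl_one (s : ℝ) (hs : -1 < s) :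
    ∫ x, Real.exp (s / (2 * (1 + s)) * x ^ 2) ∂(gaussianReal 0 1) = Real.sqrt (1 + s) := by
  have h1 : 0 < 1 + s := by linarith
  rw [integral_gaussianReal_eq_integral_smul one_ne_zero]
  have h2 : ∀ x : ℝ, gaussianPDFReal 0 1 x • Real.exp (s / (2 * (1 + s)) * x ^ 2)
      = (Real.sqrt (2 * Real.pi))⁻¹ * Real.exp (-(1 / (2 * (1 + s))) * x ^ 2) := by
    intro x
    simp only [gaussianPDFReal, smul_eq_mul, NNReal.coe_one, mul_one, sub_zero]
    rw [mul_assoc, ← Real.exp_add]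
    congr 2
    field_simp
    ring
  simp_rw [h2]
  rw [integral_const_mul, integral_gaussian, ← Real.sqrt_inv, ← Real.sqrt_mul (by positivity)]
  congr 1
  have := Real.pi_pos
  field_simp

open MeasureTheory ProbabilityTheory in
lemma jl_inner {n : ℕ} (u : EuclideanSpace ℝ (Fin n)) (hu : ‖u‖ = 1) :
    (stdGaussian (EuclideanSpace ℝ (Fin n))).map (fun x => inner ℝ u x) = gaussianReal 0 1 := by
  have h := IsGaussian.map_eq_gaussianReal (μ := stdGaussian (EuclideanSpace ℝ (Fin n)))
    (innerSL ℝ u)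
  rw [variance_dual_stdGaussian, integral_strongDual_stdGaussian] at h
  simpa [hu] using h

open MeasureTheory ProbabilityTheory in
lemma jl_two {n : ℕ} (u : EuclideanSpace ℝ (Fin n)) (hu : ‖u‖ = 1) (s : ℝ) (hs : -1 < s) :
    ∫ x, Real.exp (s / (2 * (1 + s)) * (inner ℝ u x) ^ 2)
      ∂(stdGaussian (EuclideanSpace ℝ (Fin n))) = Real.sqrt (1 + s) := by
  rw [← jl_one s hs, ← jl_inner u hu, integral_map (by fun_prop)
    (Continuous.aestronglyMeasurable (by fun_prop))]

open MeasureTheory ProbabilityTheory in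
lemma jl_three {n : ℕ} (m : ℕ) (u : EuclideanSpace ℝ (Fin n)) (hu : ‖u‖ = 1) (s : ℝ)
    (hs : -1 < s) :
    ∫ ω : Fin m → EuclideanSpace ℝ (Fin n),
      Real.exp (s / (2 * (1 + s)) * (∑ k, (inner ℝ u (ω k)) ^ 2 - (1 + s) * m))
      ∂(Measure.pi fun _ => stdGaussian (EuclideanSpace ℝ (Fin n)))
      = Real.exp (m / 2 * (Real.log (1 + s) - s)) := by
  have h1 : 0 < 1 + s := by linarith
  have h2 : ∀ ω : Fin m → EuclideanSpace ℝ (Fin n),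
      Real.exp (s / (2 * (1 + s)) * (∑ k, (inner ℝ u (ω k)) ^ 2 - (1 + s) * m))
      = Real.exp (-(m * s / 2)) * ∏ k, Real.exp (s / (2 * (1 + s)) * (inner ℝ u (ω k)) ^ 2) := by
    intro ω
    rw [← Real.exp_sum, ← Real.exp_add, ← Finset.mul_sum]
    congr 1
    field_simp
    ring
  simp_rw [h2]
  rw [integral_const_mul, integral_fintype_prod_eq_pow
    (fun x => Real.exp (s / (2 * (1 + s)) * (inner ℝ u x) ^ 2)), jl_two u hu s hs,
    Fintype.card_fin, Real.sqrt_eq_rpow, Real.rpow_def_of_pos h1, ← Real.exp_nat_mul,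
    ← Real.exp_add]
  congr 1
  ring

lemma jl_log_pos (x : ℝ) (h0 : 0 < x) : Real.log (1 + x) - x ≤ -(x ^ 2 - x ^ 3) / 2 := by
  have hm : MonotoneOn (fun y : ℝ => y - y ^ 2 / 2 + y ^ 3 / 2 - Real.log (1 + y))
      (Set.Ici 0) := by
    have hd : ∀ y : ℝ, 0 ≤ y → HasDerivAt
        (fun y : ℝ => y - y ^ 2 / 2 + y ^ 3 / 2 - Real.log (1 + y))
        (1 - (2 * y) / 2 + (3 * y ^ 2) / 2 - 1 / (1 + y)) y := by
      intro y hy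
      have := (((hasDerivAt_id y).sub (((hasDerivAt_id y).pow 2).div_const 2)).add
        (((hasDerivAt_id y).pow 3).div_const 2)).sub
        (((hasDerivAt_id y).const_add 1).log (by simp; linarith))
      exact this.congr_deriv (by simp)
    refine monotoneOn_of_deriv_nonneg (convex_Ici 0)
      (fun y hy => (hd y hy).continuousAt.continuousWithinAt)
      (fun y hy => ?_) (fun y hy => ?_)
    · rw [interior_Ici] at hy
      exact (hd y (le_of_lt hy)).differentiableAt.differentiableWithinAt
    · rw [interior_Ici] at hy
      have hy' : 0 < y := hy
      rw [(hd y hy'.le).deriv]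
      have : 1 - (2 * y) / 2 + (3 * y ^ 2) / 2 - 1 / (1 + y)
        = (y ^ 2 / 2 + 3 * y ^ 3 / 2) / (1 + y) := by field_simp; ring
      rw [this]; positivity
  have := hm (Set.mem_Ici.2 le_rfl) (Set.mem_Ici.2 h0.le) h0.le
  simp at this
  linarith

lemma jl_log_neg (x : ℝ) (h0 : 0 < x) (h1 : x < 1) :
    Real.log (1 + -x) - -x ≤ -(x ^ 2 - x ^ 3) / 2 := by
  have hm : MonotoneOn (fun y : ℝ => - y - y ^ 2 / 2 - Real.log (1 - y))
      (Set.Ico 0 1) := by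
    have hd : ∀ y : ℝ, y < 1 → HasDerivAt
        (fun y : ℝ => - y - y ^ 2 / 2 - Real.log (1 - y))
        (-1 - (2 * y) / 2 - (-1) / (1 - y)) y := by
      intro y hy
      have := (((hasDerivAt_id y).neg.sub (((hasDerivAt_id y).pow 2).div_const 2))).sub
        (((hasDerivAt_id y).const_sub 1).log (by simp; linarith))
      exact this.congr_deriv (by simp)
    refine monotoneOn_of_deriv_nonneg (convex_Ico 0 1)
      (fun y hy => (hd y hy.2).continuousAt.continuousWithinAt)
      (fun y hy => ?_) (fun y hy => ?_)
    · rw [interior_Ico] at hy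
      exact (hd y hy.2).differentiableAt.differentiableWithinAt
    · rw [interior_Ico] at hy
      have hy' : 0 < 1 - y := by linarith [hy.2]
      rw [(hd y hy.2).deriv]
      have : -1 - (2 * y) / 2 - (-1) / (1 - y)
        = (y ^ 2) / (1 - y) := by field_simp; ring
      rw [this]; positivity
  have := hm (Set.mem_Ico.2 ⟨le_rfl, one_pos⟩) (Set.mem_Ico.2 ⟨h0.le, h1⟩) h0.le
  have h3 : 0 < x ^ 3 := by positivity
  simp at this
  rw [← sub_eq_add_neg]
  linarith

/-- **Johnson–Lindenstrauss theorem** (Theorem 1 of the paper, with the explicit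
sufficient bound `μ ≥ 8 ln N / (ε² − ε³)`): for any `N` points `z 1, …, z N` in `ℝ^n`,
any `ε ∈ (0,1)` and any positive integer `μ ≥ 8 ln N / (ε² − ε³)`, there is a map
`G : ℝ^n → ℝ^μ` preserving all pairwise squared Euclidean distances up to factors
`1 − ε` and `1 + ε`. -/
theorem johnson_lindenstrauss
    (N n : ℕ) (hN : 0 < N) (hn : 0 < n)
    (z : Fin N → EuclideanSpace ℝ (Fin n))
    (ε : ℝ) (hε : ε ∈ Set.Ioo (0 : ℝ) 1)
    (μ : ℕ) (hμ : 0 < μ) (hμ_ge : 8 * Real.log N / (ε ^ 2 - ε ^ 3) ≤ (μ : ℝ)) :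
    ∃ G : EuclideanSpace ℝ (Fin n) → EuclideanSpace ℝ (Fin μ),
      ∀ i j : Fin N,
        (1 - ε) * ‖z i - z j‖ ^ 2 ≤ ‖G (z i) - G (z j)‖ ^ 2 ∧
        ‖G (z i) - G (z j)‖ ^ 2 ≤ (1 + ε) * ‖z i - z j‖ ^ 2 := by
  obtain ⟨h0, h1⟩ := hε
  have hd : 0 < ε ^ 2 - ε ^ 3 := by
    have : 0 < ε ^ 2 * (1 - ε) := by have : 0 < 1 - ε := by linarith
                                     positivity
    linarith
  rw [div_le_iff₀ hd] at hμ_ge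
  have hNr : (0 : ℝ) < N := by exact_mod_cast hN
  have hmr : (0 : ℝ) < μ := by exact_mod_cast hμ
  let S : Finset (Fin N × Fin N) := Finset.univ.offDiag.filter (fun p => z p.1 ≠ z p.2)
  let s : Fin N × Fin N → ℝ := fun p => if p.1 < p.2 then ε else -ε
  let u : Fin N × Fin N → EuclideanSpace ℝ (Fin n) :=
    fun p => ‖z p.1 - z p.2‖⁻¹ • (z p.1 - z p.2)
  let P : MeasureTheory.Measure (Fin μ → EuclideanSpace ℝ (Fin n)) :=
    MeasureTheory.Measure.pi fun _ => ProbabilityTheory.stdGaussian (EuclideanSpace ℝ (Fin n))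
  let F : Fin N × Fin N → (Fin μ → EuclideanSpace ℝ (Fin n)) → ℝ := fun p ω =>
    Real.exp (s p / (2 * (1 + s p)) * (∑ k, (inner ℝ (u p) (ω k)) ^ 2 - (1 + s p) * μ))
  have hs : ∀ p, -1 < s p := by
    intro p; simp only [s]; split_ifs <;> linarith
  have hu : ∀ p ∈ S, ‖u p‖ = 1 := by
    intro p hp
    have hp2 : z p.1 ≠ z p.2 := (Finset.mem_filter.1 hp).2
    have : ‖z p.1 - z p.2‖ ≠ 0 := norm_ne_zero_iff.2 (sub_ne_zero.2 hp2)
    simp only [u]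
    rw [norm_smul, norm_inv, norm_norm, inv_mul_cancel₀ this]
  have hF : ∀ p ∈ S, ∫ ω, F p ω ∂P = Real.exp (μ / 2 * (Real.log (1 + s p) - s p)) :=
    fun p hp => jl_three μ (u p) (hu p hp) (s p) (hs p)
  have hFi : ∀ p ∈ S, MeasureTheory.Integrable (F p) P := by
    intro p hp
    apply MeasureTheory.Integrable.of_integral_ne_zero
    rw [hF p hp]
    exact (Real.exp_pos _).ne'
  have hle : ∀ p ∈ S, ∫ ω, F p ω ∂P ≤ 1 / (N : ℝ) ^ 2 := by
    intro p hp
    rw [hF p hp]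
    have hl : Real.log (1 + s p) - s p ≤ -(ε ^ 2 - ε ^ 3) / 2 := by
      simp only [s]
      split_ifs
      · exact jl_log_pos ε h0
      · exact jl_log_neg ε h0 h1
    have : 1 / (N : ℝ) ^ 2 = Real.exp (-(2 * Real.log N)) := by
      rw [Real.exp_neg, ← Real.log_rpow hNr, Real.exp_log (by positivity)]
      simp
    rw [this]
    apply Real.exp_le_exp.2
    calc (μ : ℝ) / 2 * (Real.log (1 + s p) - s p) ≤ μ / 2 * (-(ε ^ 2 - ε ^ 3) / 2) := by
          gcongr
      _ ≤ _ := by linarith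
  have hsum : ∫ ω, ∑ p ∈ S, F p ω ∂P < 1 := by
    rw [MeasureTheory.integral_finsetSum S hFi]
    have hc : (S.card : ℝ) < (N : ℝ) ^ 2 := by
      have h2 : S.card ≤ (Finset.univ : Finset (Fin N)).offDiag.card := Finset.card_filter_le _ _
      rw [Finset.offDiag_card, Finset.card_univ, Fintype.card_fin] at h2
      have h3 : 0 < N * N := by positivity
      have : S.card < N ^ 2 := by rw [pow_two]; omega
      exact_mod_cast this
    calc ∑ p ∈ S, ∫ ω, F p ω ∂P ≤ S.card • (1 / (N : ℝ) ^ 2) := Finset.sum_le_card_nsmul _ _ _ hle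
      _ < 1 := by
        rw [nsmul_eq_mul, mul_one_div, div_lt_one (by positivity)]
        exact hc
  obtain ⟨ω, hω⟩ := MeasureTheory.exists_le_integral (MeasureTheory.integrable_finsetSum S hFi)
  have hω1 := lt_of_le_of_lt hω hsum
  have key : ∀ p ∈ S, s p * (∑ k, (inner ℝ (u p) (ω k)) ^ 2 - (1 + s p) * μ) < 0 := by
    intro p hp
    have hlt : F p ω < 1 := lt_of_le_of_lt
      (Finset.single_le_sum (f := fun p => F p ω) (fun q _ => (Real.exp_pos _).le) hp) hω1
    have h3 := Real.exp_lt_one_iff.1 hlt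
    have h4 : 0 < 1 + s p := by linarith [hs p]
    rw [div_mul_eq_mul_div, div_lt_iff₀ (by positivity), zero_mul] at h3
    exact h3
  let G : EuclideanSpace ℝ (Fin n) → EuclideanSpace ℝ (Fin μ) :=
    fun x => WithLp.toLp 2 (fun k => (Real.sqrt μ)⁻¹ * inner ℝ x (ω k))
  have hG : ∀ i j, ‖G (z i) - G (z j)‖ ^ 2 =
      ‖z i - z j‖ ^ 2 * ((∑ k, (inner ℝ (u (i, j)) (ω k)) ^ 2) / μ) := by
    intro i j
    rw [EuclideanSpace.real_norm_sq_eq]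
    simp only [G, u, PiLp.sub_apply, ← mul_sub, ← inner_sub_left, real_inner_smul_left, mul_pow,
      ← Finset.mul_sum, inv_pow, Real.sq_sqrt hmr.le]
    by_cases hz : ‖z i - z j‖ = 0
    · rw [norm_eq_zero] at hz
      simp [hz]
    · field_simp
  have hsym : ∀ i j, ‖G (z i) - G (z j)‖ ^ 2 = ‖G (z j) - G (z i)‖ ^ 2 := fun i j => by
    rw [norm_sub_rev]
  have hup : ∀ i j, i < j → z i ≠ z j →
      ‖G (z i) - G (z j)‖ ^ 2 ≤ (1 + ε) * ‖z i - z j‖ ^ 2 := by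
    intro i j hij hz
    have h := key (i, j) (by simp [S, hij.ne, hz])
    simp only [s, hij, if_true] at h
    have h' := neg_of_mul_neg_right h h0.le
    rw [hG, mul_comm]
    gcongr
    rw [div_le_iff₀ hmr]; linarith
  have hlo : ∀ i j, i < j → z i ≠ z j →
      (1 - ε) * ‖z i - z j‖ ^ 2 ≤ ‖G (z i) - G (z j)‖ ^ 2 := by
    intro i j hij hz
    have h := key (j, i) (by simp [S, hij.ne', hz.symm])
    simp only [s, not_lt.2 hij.le, if_false] at h
    have h' : 0 < (∑ k, (inner ℝ (u (j, i)) (ω k)) ^ 2 - (1 + -ε) * μ) := by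
      by_contra hcon
      push Not at hcon
      nlinarith
    rw [hsym, hG, mul_comm, norm_sub_rev]
    gcongr
    rw [le_div_iff₀ hmr]; linarith
  refine ⟨G, fun i j => ?_⟩
  by_cases hz : z i = z j
  · simp [hz]
  · rcases lt_trichotomy i j with h | h | h
    · exact ⟨hlo i j h hz, hup i j h hz⟩
    · exact absurd (congrArg z h) hz
    · rw [hsym, norm_sub_rev (z i)]
      exact ⟨hlo j i h (Ne.symm hz), hup j i h (Ne.symm hz)⟩
end

section
/- Let n, μ be positive integers, let ε ∈ (0,1), and let R be a μ × n random matrix whose entries r_{ij} are independent standard normal random variables (i.e., R is distributed according to the product of μ·n standard Gaussian measures on ℝ). Define the random linear map G(z) = (1/√μ) R z for z ∈ ℝ^n. Then for every fixed z ∈ ℝ^n, the event { (1 − ε)·‖z‖² ≤ ‖G(z)‖² ≤ (1 + ε)·‖z‖² } has probability at least 1 − 2·exp(−(ε² − ε³)·μ/4), where ‖·‖ denotes the Euclidean norm. -/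
open MeasureTheory ProbabilityTheory Real

lemma sq_int (t : ℝ) (ht : t < 1/2) :
    ∫ x, rexp (t * x^2) ∂(gaussianReal 0 1) = (√(1 - 2*t))⁻¹ := by
  rw [integral_gaussianReal_eq_integral_smul one_ne_zero]
  have : ∀ x : ℝ, gaussianPDFReal 0 1 x • rexp (t * x^2) = (√(2*π))⁻¹ * rexp (-(1/2 - t) * x^2) := by
    intro x
    simp only [gaussianPDFReal, smul_eq_mul, NNReal.coe_one, mul_one, sub_zero]
    rw [mul_assoc, ← Real.exp_add]
    congr 2; ring
  simp_rw [this]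
  rw [integral_const_mul, integral_gaussian, ← Real.sqrt_inv, ← Real.sqrt_inv, ← Real.sqrt_mul (by positivity)]
  congr 1
  have : 1 - 2*t ≠ 0 := by linarith
  have : 1/2 - t ≠ 0 := by intro h; linarith
  have := Real.pi_ne_zero
  field_simp

lemma pi_sq_int (m : ℕ) (t : ℝ) (ht : t < 1/2) :
    mgf (fun y : Fin m → ℝ => ∑ i, y i ^ 2) (Measure.pi fun _ : Fin m => gaussianReal 0 1) t
      = (√(1 - 2*t))⁻¹ ^ m := by
  unfold mgf
  simp_rw [Finset.mul_sum, Real.exp_sum]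
  rw [integral_fintype_prod_eq_prod (f := fun _ x => rexp (t * x^2))]
  simp [sq_int t ht]

lemma pi_sq_integrable (m : ℕ) (t : ℝ) (ht : t < 1/2) :
    Integrable (fun y : Fin m → ℝ => rexp (t * ∑ i, y i ^ 2)) (Measure.pi fun _ : Fin m => gaussianReal 0 1) := by
  by_contra h
  have h1 := integral_undef h
  have h2 := pi_sq_int m t ht
  unfold mgf at h2
  rw [h1] at h2
  have : 0 < √(1 - 2*t) := Real.sqrt_pos.2 (by linarith)
  have : 0 < (√(1 - 2*t))⁻¹ ^ m := by positivity
  linarith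

lemma row_law (n : ℕ) (w : Fin n → ℝ) (hw : ∑ j, w j ^ 2 = 1) :
    (Measure.pi fun _ : Fin n => gaussianReal 0 1).map (fun x => ∑ j, x j * w j) = gaussianReal 0 1 := by
  have hm : Measurable (fun x : Fin n → ℝ => ∑ j, x j * w j) := by fun_prop
  have : IsProbabilityMeasure ((Measure.pi fun _ : Fin n => gaussianReal 0 1).map (fun x => ∑ j, x j * w j)) :=
    Measure.isProbabilityMeasure_map hm.aemeasurable
  apply Measure.ext_of_charFun
  ext t
  rw [charFun_apply_real, integral_map hm.aemeasurable (by fun_prop)]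
  have : ∀ x : Fin n → ℝ, Complex.exp (t * ((∑ j, x j * w j : ℝ) : ℂ) * Complex.I)
     = ∏ j, Complex.exp (((t * w j : ℝ) : ℂ) * (x j : ℂ) * Complex.I) := by
    intro x
    rw [← Complex.exp_sum]
    congr 1
    push_cast
    rw [Finset.mul_sum, Finset.sum_mul]
    exact Finset.sum_congr rfl fun j _ => by ring
  simp_rw [this]
  rw [integral_fintype_prod_eq_prod (f := fun j (x : ℝ) => Complex.exp (((t * w j : ℝ) : ℂ) * (x : ℂ) * Complex.I))]
  simp_rw [← charFun_apply_real, charFun_gaussianReal]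
  rw [← Complex.exp_sum]
  congr 1
  have hw' : ∑ j, (w j : ℂ) ^ 2 = 1 := by exact_mod_cast hw
  push_cast
  calc _ = ∑ j, (-(t:ℂ)^2/2) * (w j : ℂ)^2 := Finset.sum_congr rfl fun j _ => by ring
    _ = _ := by rw [← Finset.mul_sum, hw']; ring

lemma mat_law (n m : ℕ) (w : Fin n → ℝ) (hw : ∑ j, w j ^ 2 = 1) :
    (Measure.pi fun _ : Fin m => Measure.pi fun _ : Fin n => gaussianReal 0 1).map
      (fun R i => ∑ j, R i j * w j) = Measure.pi fun _ : Fin m => gaussianReal 0 1 := by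
  have := Measure.pi_map_pi (μ := fun _ : Fin m => Measure.pi fun _ : Fin n => gaussianReal 0 1)
    (f := fun _ (x : Fin n → ℝ) => ∑ j, x j * w j) (hμ := ?_) (fun i => Measurable.aemeasurable (by fun_prop))
  · rw [this]; simp_rw [row_law n w hw]
  · intro i; rw [row_law n w hw]; infer_instance

lemma log_up (ε : ℝ) (h0 : 0 < ε) : 1 + ε ≤ rexp (ε - (ε^2 - ε^3)/2) := by
  have hd : ∀ x : ℝ, 0 ≤ x → HasDerivAt (fun x : ℝ => (1+x) * rexp (-(x - (x^2-x^3)/2)))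
      (1 * rexp (-(x - (x^2-x^3)/2)) + (1+x) * (rexp (-(x - (x^2-x^3)/2)) * (-(1 - (2*x-3*x^2)/2)))) x := by
    intro x _
    refine HasDerivAt.mul ((hasDerivAt_id x).const_add 1) (HasDerivAt.exp ?_)
    refine (((hasDerivAt_id' x).sub (((hasDerivAt_pow 2 x).sub (hasDerivAt_pow 3 x)).div_const 2))).neg.congr_deriv ?_
    norm_num
  have ha : AntitoneOn (fun x : ℝ => (1+x) * rexp (-(x - (x^2-x^3)/2))) (Set.Ici 0) := by
    refine antitoneOn_of_deriv_nonpos (convex_Ici 0) (by fun_prop) (by fun_prop) ?_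
    intro x hx
    simp only [interior_Ici, Set.mem_Ioi] at hx
    rw [(hd x hx.le).deriv]
    have he := Real.exp_pos (-(x - (x^2-x^3)/2))
    have : 1 * rexp (-(x - (x^2-x^3)/2)) + (1+x) * (rexp (-(x - (x^2-x^3)/2)) * (-(1 - (2*x-3*x^2)/2)))
      = - (rexp (-(x - (x^2-x^3)/2)) * (x^2 * (1 + 3 * x) / 2)) := by ring
    rw [this]
    have : 0 ≤ rexp (-(x - (x^2-x^3)/2)) * (x^2 * (1 + 3 * x) / 2) := by positivity
    linarith
  have := ha (Set.mem_Ici.2 le_rfl) (Set.mem_Ici.2 h0.le) h0.le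
  simp only at this
  norm_num at this
  calc 1 + ε = (1+ε) * rexp ((ε^2 - ε^3)/2 - ε) * rexp (ε - (ε^2 - ε^3)/2) := by
        rw [mul_assoc, ← Real.exp_add]; simp
    _ ≤ 1 * rexp (ε - (ε^2 - ε^3)/2) := by gcongr
    _ = _ := one_mul _

lemma log_low (ε : ℝ) (h0 : 0 < ε) (h1 : ε < 1) : 1 - ε ≤ rexp (-ε - (ε^2 - ε^3)/2) := by
  have hd : ∀ x : ℝ, HasDerivAt (fun x : ℝ => (1-x) * rexp (x + (x^2-x^3)/2))
      ((-1) * rexp (x + (x^2-x^3)/2) + (1-x) * (rexp (x + (x^2-x^3)/2) * (1 + (2*x-3*x^2)/2))) x := by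
    intro x
    refine HasDerivAt.mul ((hasDerivAt_id x).const_sub 1) (HasDerivAt.exp ?_)
    refine (((hasDerivAt_id' x).add (((hasDerivAt_pow 2 x).sub (hasDerivAt_pow 3 x)).div_const 2))).congr_deriv ?_
    norm_num
  have ha : AntitoneOn (fun x : ℝ => (1-x) * rexp (x + (x^2-x^3)/2)) (Set.Icc 0 1) := by
    refine antitoneOn_of_deriv_nonpos (convex_Icc 0 1) (by fun_prop) (by fun_prop) ?_
    intro x hx
    simp only [interior_Icc, Set.mem_Ioo] at hx
    rw [(hd x).deriv]
    have : (-1) * rexp (x + (x^2-x^3)/2) + (1-x) * (rexp (x + (x^2-x^3)/2) * (1 + (2*x-3*x^2)/2))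
      = - (rexp (x + (x^2-x^3)/2) * (x^2 * (1 + 1.5 * (1 - x)))) := by ring
    rw [this]
    have h2 : 0 < 1 - x := by linarith [hx.2]
    have : 0 ≤ rexp (x + (x^2-x^3)/2) * (x^2 * (1 + 1.5 * (1 - x))) := by positivity
    linarith
  have := ha (Set.mem_Icc.2 ⟨le_rfl, zero_le_one⟩) (Set.mem_Icc.2 ⟨h0.le, h1.le⟩) h0.le
  simp only at this
  norm_num at this
  calc 1 - ε = (1-ε) * rexp (ε + (ε^2 - ε^3)/2) * rexp (-ε - (ε^2 - ε^3)/2) := by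
        rw [mul_assoc, ← Real.exp_add,
          show ε + (ε^2 - ε^3)/2 + (-ε - (ε^2 - ε^3)/2) = 0 by ring, Real.exp_zero, mul_one]
    _ ≤ 1 * rexp (-ε - (ε^2 - ε^3)/2) := by gcongr
    _ = _ := one_mul _

/-- Chernoff tail estimate, with `d = ε` (upper) or `d = -ε` (lower). -/
lemma chern (m : ℕ) (d q : ℝ) (hd : -1 < d) (h : 1 + d ≤ rexp (d - q/2)) :
    rexp (-(d / (2 * (1+d))) * ((1+d) * m)) * (√(1 - 2*(d / (2 * (1+d)))))⁻¹ ^ m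
      ≤ rexp (-q * m / 4) := by
  have h1 : 0 < 1 + d := by linarith
  have e1 : 1 - 2*(d / (2 * (1+d))) = (1+d)⁻¹ := by field_simp; ring
  have e2 : -(d / (2 * (1+d))) * ((1+d) * m) = m * (-d/2) := by field_simp
  rw [e1, e2, Real.sqrt_inv, inv_inv, Real.exp_nat_mul, ← mul_pow]
  have hs : √(1+d) ≤ rexp ((d - q/2)/2) := by
    rw [Real.exp_half]; exact Real.sqrt_le_sqrt h
  calc _ ≤ (rexp (-d/2) * rexp ((d - q/2)/2)) ^ m := by gcongr
    _ = _ := by rw [← Real.exp_add, ← Real.exp_nat_mul]; congr 1; ring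

/-- **Lemma 1 of the paper** (norm preservation of a linear Gaussian random projection):
if `R` is a `μ × n` random matrix with i.i.d. standard normal entries (its law `P` being
the product of `μ·n` standard Gaussian measures) and `G(z) = (1/√μ) R z`, then for every
fixed `z ∈ ℝ^n` the event `{(1−ε)‖z‖² ≤ ‖G(z)‖² ≤ (1+ε)‖z‖²}` has probability at least
`1 − 2 exp(−(ε² − ε³) μ / 4)`. -/
theorem gaussian_random_projection_norm_preservation
    (n μ : ℕ) (hn : 0 < n) (hμ : 0 < μ)
    (ε : ℝ) (hε : ε ∈ Set.Ioo (0 : ℝ) 1)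
    (P : Measure (Fin μ → Fin n → ℝ))
    (hP : P = Measure.pi fun _ : Fin μ => Measure.pi fun _ : Fin n => gaussianReal 0 1)
    (G : (Fin μ → Fin n → ℝ) → EuclideanSpace ℝ (Fin n) → EuclideanSpace ℝ (Fin μ))
    (hG : ∀ R z, G R z = fun i : Fin μ => (Real.sqrt μ)⁻¹ * ∑ j : Fin n, R i j * z j)
    (z : EuclideanSpace ℝ (Fin n)) :
    ENNReal.ofReal (1 - 2 * Real.exp (-(ε ^ 2 - ε ^ 3) * μ / 4)) ≤
      P {R | (1 - ε) * ‖z‖ ^ 2 ≤ ‖G R z‖ ^ 2 ∧ ‖G R z‖ ^ 2 ≤ (1 + ε) * ‖z‖ ^ 2} := by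
  obtain ⟨h0, h1⟩ := hε
  have hPp : IsProbabilityMeasure P := by rw [hP]; infer_instance
  have hμ' : (0 : ℝ) < μ := by exact_mod_cast hμ
  have hGn : ∀ R, ‖G R z‖ ^ 2 = (μ : ℝ)⁻¹ * ∑ i, (∑ j, R i j * z j) ^ 2 := by
    intro R
    rw [EuclideanSpace.real_norm_sq_eq, Finset.mul_sum]
    refine Finset.sum_congr rfl fun i _ => ?_
    rw [hG, mul_pow, inv_pow, Real.sq_sqrt hμ'.le]
  by_cases hz : z = 0
  · have : {R | (1 - ε) * ‖z‖ ^ 2 ≤ ‖G R z‖ ^ 2 ∧ ‖G R z‖ ^ 2 ≤ (1 + ε) * ‖z‖ ^ 2} = Set.univ := by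
      ext R
      have hg : ‖G R z‖ ^ 2 = 0 := by rw [hGn]; simp [hz]
      have hz0 : ‖z‖ = 0 := by simp [hz]
      simp only [Set.mem_setOf_eq, hg, hz0, Set.mem_univ, iff_true]
      norm_num
    rw [this, measure_univ, ENNReal.ofReal_le_one]
    have := Real.exp_pos (-(ε ^ 2 - ε ^ 3) * μ / 4)
    linarith
  have hzp : 0 < ‖z‖ := norm_pos_iff.2 hz
  set w : Fin n → ℝ := fun j => ‖z‖⁻¹ * z j with hw_def
  have hw : ∑ j, w j ^ 2 = 1 := by
    simp only [hw_def, mul_pow]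
    rw [← Finset.mul_sum, ← EuclideanSpace.real_norm_sq_eq]
    field_simp
  set T : (Fin μ → Fin n → ℝ) → (Fin μ → ℝ) := fun R i => ∑ j, R i j * w j with hT
  have hTm : Measurable T := by fun_prop
  set Q : Measure (Fin μ → ℝ) := Measure.pi fun _ : Fin μ => gaussianReal 0 1 with hQ
  have hlaw : P.map T = Q := by rw [hP]; exact mat_law n μ w hw
  have hGT : ∀ R, ‖G R z‖ ^ 2 = ‖z‖ ^ 2 * ((μ : ℝ)⁻¹ * ∑ i, T R i ^ 2) := by
    intro R
    rw [hGn, mul_left_comm]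
    congr 1
    rw [Finset.mul_sum]
    refine Finset.sum_congr rfl fun i _ => ?_
    rw [← mul_pow]
    congr 1
    simp only [hT, hw_def]
    rw [Finset.mul_sum]
    refine Finset.sum_congr rfl fun j _ => ?_
    field_simp
  set X : (Fin μ → ℝ) → ℝ := fun y => ∑ i, y i ^ 2 with hX
  have hXm : Measurable X := by fun_prop
  have hup : Q.real {y | (1 + ε) * μ ≤ X y} ≤ rexp (-(ε ^ 2 - ε ^ 3) * μ / 4) := by
    have ht : ε / (2 * (1 + ε)) < 1/2 := by
      rw [div_lt_div_iff₀ (by linarith) (by norm_num)]; linarith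
    refine (measure_ge_le_exp_mul_mgf (t := ε / (2 * (1 + ε))) _ (by positivity)
      (pi_sq_integrable μ _ ht)).trans ?_
    rw [pi_sq_int μ _ ht]
    exact chern μ ε (ε^2 - ε^3) (by linarith) (log_up ε h0)
  have hlo : Q.real {y | X y ≤ (1 - ε) * μ} ≤ rexp (-(ε ^ 2 - ε ^ 3) * μ / 4) := by
    have hneg : -ε / (2 * (1 + -ε)) ≤ 0 :=
      div_nonpos_of_nonpos_of_nonneg (by linarith) (by linarith)
    have ht : -ε / (2 * (1 + -ε)) < 1/2 := by linarith
    refine (measure_le_le_exp_mul_mgf (t := -ε / (2 * (1 + -ε))) _ hneg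
      (pi_sq_integrable μ _ ht)).trans ?_
    rw [pi_sq_int μ _ ht, sub_eq_add_neg 1 ε]
    exact chern μ (-ε) (ε^2 - ε^3) (by linarith) (by
      have := log_low ε h0 h1
      rwa [sub_eq_add_neg 1 ε] at this)
  set B : Set (Fin μ → ℝ) := {y | (1 + ε) * μ ≤ X y} ∪ {y | X y ≤ (1 - ε) * μ} with hB
  have hBm : MeasurableSet B :=
    (measurableSet_le measurable_const hXm).union (measurableSet_le hXm measurable_const)
  have hBr : P.real (T ⁻¹' B) ≤ 2 * rexp (-(ε ^ 2 - ε ^ 3) * μ / 4) := by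
    rw [← map_measureReal_apply hTm hBm, hlaw]
    refine (measureReal_union_le _ _).trans ?_
    linarith
  have hsub : (T ⁻¹' B)ᶜ ⊆
      {R | (1 - ε) * ‖z‖ ^ 2 ≤ ‖G R z‖ ^ 2 ∧ ‖G R z‖ ^ 2 ≤ (1 + ε) * ‖z‖ ^ 2} := by
    intro R hR
    have hR' : ¬ ((1 + ε) * μ ≤ X (T R) ∨ X (T R) ≤ (1 - ε) * μ) := hR
    push Not at hR'
    obtain ⟨ha, hb⟩ := hR'
    change (1 - ε) * ‖z‖ ^ 2 ≤ ‖G R z‖ ^ 2 ∧ ‖G R z‖ ^ 2 ≤ (1 + ε) * ‖z‖ ^ 2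
    have e : ‖G R z‖ ^ 2 = (X (T R) / μ) * ‖z‖ ^ 2 := by rw [hGT]; simp only [hX]; ring
    rw [e]
    have hb' : 1 - ε ≤ X (T R) / μ := by rw [le_div_iff₀ hμ']; exact hb.le
    have ha' : X (T R) / μ ≤ 1 + ε := by rw [div_le_iff₀ hμ']; exact ha.le
    exact ⟨by gcongr, by gcongr⟩
  refine le_trans ?_ (measure_mono hsub)
  rw [← ofReal_measureReal, probReal_compl_eq_one_sub (hTm hBm)]
  exact ENNReal.ofReal_le_ofReal (by linarith)
end

section
/- Let μ be a positive integer, let ε ∈ (0,1), and let X_1, ..., X_μ be independent standard normal random variables. Then the probability that (1/μ)·∑_{j=1}^{μ} X_j² lies outside the interval [1 − ε, 1 + ε] is at most 2·exp(−(ε² − ε³)·μ/4). -/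
open MeasureTheory ProbabilityTheory Real

theorem csc_log_add {x : ℝ} (h0 : 0 < x) : Real.log (1 + x) ≤ x - x ^ 2 / 2 + x ^ 3 / 2 := by
  have hd : ∀ y : ℝ, 0 ≤ y → HasDerivAt (fun y : ℝ => y - y ^ 2 / 2 + y ^ 3 / 2 - Real.log (1 + y))
      (1 - y + 3 * y ^ 2 / 2 - 1 / (1 + y)) y := by
    intro y hy
    have h1 : HasDerivAt (fun y : ℝ => Real.log (1 + y)) (1 / (1 + y)) y :=
      ((hasDerivAt_id y).const_add 1).log (by simp; linarith)
    have h2 := (((hasDerivAt_id y).sub (((hasDerivAt_id y).pow 2).div_const 2)).add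
      (((hasDerivAt_id y).pow 3).div_const 2)).sub h1
    convert! h2 using 1
    simp
  have hm : MonotoneOn (fun y : ℝ => y - y ^ 2 / 2 + y ^ 3 / 2 - Real.log (1 + y)) (Set.Ici 0) := by
    apply monotoneOn_of_deriv_nonneg (convex_Ici 0)
    · intro y hy
      exact (hd y hy).continuousAt.continuousWithinAt
    · intro y hy
      rw [interior_Ici] at hy
      exact (hd y (le_of_lt hy)).differentiableAt.differentiableWithinAt
    · intro y hy
      rw [interior_Ici] at hy
      have hy' : 0 < y := hy
      rw [(hd y hy'.le).deriv]
      have : 1 - y + 3 * y ^ 2 / 2 - 1 / (1 + y) = y ^ 2 * (1 + 3 * y) / (2 * (1 + y)) := by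
        field_simp
        ring
      rw [this]
      positivity
  have := hm (Set.mem_Ici.2 le_rfl) (Set.mem_Ici.2 h0.le) h0.le
  simp at this
  linarith

theorem csc_log_sub {x : ℝ} (h0 : 0 < x) (h1 : x < 1) :
    Real.log (1 - x) ≤ - x - x ^ 2 / 2 := by
  have h := Real.hasSum_pow_div_log_of_abs_lt_one (x := x) (by rw [abs_lt]; constructor <;> linarith)
  have := sum_le_hasSum (Finset.range 2) (fun i _ => by positivity) h
  norm_num [Finset.sum_range_succ] at this
  linarith

theorem csc_gauss {a : ℝ} (ha : 0 < a) (x : ℝ) :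
    gaussianPDFReal 0 1 x • Real.exp ((1 - 1 / a) / 2 * x ^ 2)
      = (√(2 * π))⁻¹ * Real.exp (-(1 / (2 * a)) * x ^ 2) := by
  rw [gaussianPDFReal, smul_eq_mul, mul_assoc, ← Real.exp_add]
  simp only [NNReal.coe_one, mul_one, sub_zero]
  congr 2
  field_simp
  ring

theorem csc_integral {a : ℝ} (ha : 0 < a) :
    ∫ x, Real.exp ((1 - 1 / a) / 2 * x ^ 2) ∂(gaussianReal 0 1) = Real.exp (Real.log a / 2) := by
  rw [integral_gaussianReal_eq_integral_smul one_ne_zero]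
  simp_rw [csc_gauss ha]
  rw [integral_const_mul, integral_gaussian, ← Real.sqrt_inv, ← Real.sqrt_mul (by positivity),
    Real.exp_half, Real.exp_log ha]
  congr 1
  field_simp

theorem csc_integrable {a : ℝ} (ha : 0 < a) :
    Integrable (fun x : ℝ => Real.exp ((1 - 1 / a) / 2 * x ^ 2)) (gaussianReal 0 1) := by
  apply Integrable.of_integral_ne_zero
  rw [csc_integral ha]
  positivity

theorem csc_sum_integrable (n : ℕ) {a : ℝ} (ha : 0 < a) :
    Integrable (fun X : Fin n → ℝ => Real.exp ((1 - 1 / a) / 2 * ∑ j, X j ^ 2))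
      (Measure.pi fun _ : Fin n => gaussianReal 0 1) := by
  simp_rw [Finset.mul_sum, Real.exp_sum]
  exact Integrable.fintype_prod (fun _ => csc_integrable ha)

theorem csc_mgf (n : ℕ) {a : ℝ} (ha : 0 < a) :
    mgf (fun X : Fin n → ℝ => ∑ j, X j ^ 2) (Measure.pi fun _ : Fin n => gaussianReal 0 1)
      ((1 - 1 / a) / 2) = Real.exp (n * (Real.log a / 2)) := by
  rw [mgf]
  simp_rw [Finset.mul_sum, Real.exp_sum]
  rw [integral_fintype_prod_eq_pow (fun x : ℝ => Real.exp ((1 - 1 / a) / 2 * x ^ 2)),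
    csc_integral ha, Fintype.card_fin, Real.exp_nat_mul]

theorem csc_combine (n : ℕ) {a : ℝ} (ha : 0 < a) :
    Real.exp (-((1 - 1 / a) / 2) * (n * a)) * Real.exp (n * (Real.log a / 2))
      = Real.exp (n / 2 * (1 - a + Real.log a)) := by
  rw [← Real.exp_add]
  congr 1
  field_simp
  ring

/-- **Chi-squared concentration inequality** used to prove Lemma 1 of the paper:
if `X 1, …, X μ` are i.i.d. standard normal random variables (the underlying probability
measure being the product of `μ` standard Gaussian measures on `ℝ`), then the probability
that `(1/μ) ∑ j, (X j)²` lies outside `[1 − ε, 1 + ε]` is at most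
`2 exp(−(ε² − ε³) μ / 4)`. -/
theorem chi_squared_concentration
    (μ : ℕ) (hμ : 0 < μ)
    (ε : ℝ) (hε : ε ∈ Set.Ioo (0 : ℝ) 1)
    (P : Measure (Fin μ → ℝ))
    (hP : P = Measure.pi fun _ : Fin μ => gaussianReal 0 1) :
    P {X | (1 / (μ : ℝ)) * ∑ j : Fin μ, (X j) ^ 2 ∉ Set.Icc (1 - ε) (1 + ε)} ≤
      ENNReal.ofReal (2 * Real.exp (-(ε ^ 2 - ε ^ 3) * μ / 4)) := by
  obtain ⟨h0, h1⟩ := hε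
  have hn : (0 : ℝ) < μ := by exact_mod_cast hμ
  subst hP
  set P := Measure.pi fun _ : Fin μ => gaussianReal 0 1 with hP
  have hp : (0 : ℝ) < 1 + ε := by linarith
  have hm : (0 : ℝ) < 1 - ε := by linarith
  have hsub : {X : Fin μ → ℝ | (1 / (μ : ℝ)) * ∑ j : Fin μ, (X j) ^ 2 ∉ Set.Icc (1 - ε) (1 + ε)} ⊆
      {X | (μ : ℝ) * (1 + ε) ≤ ∑ j : Fin μ, (X j) ^ 2} ∪
      {X | ∑ j : Fin μ, (X j) ^ 2 ≤ (μ : ℝ) * (1 - ε)} := by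
    intro X hX
    by_contra hc
    simp only [Set.mem_union, Set.mem_ofPred_eq, not_or, not_le] at hc
    apply hX
    rw [one_div, inv_mul_eq_div, Set.mem_Icc, le_div_iff₀ hn, div_le_iff₀ hn]
    constructor <;> linarith [hc.1, hc.2]
  have hU : P.real {X | (μ : ℝ) * (1 + ε) ≤ ∑ j : Fin μ, (X j) ^ 2} ≤
      Real.exp (-(ε ^ 2 - ε ^ 3) * μ / 4) := by
    have ht : 0 ≤ (1 - 1 / (1 + ε)) / 2 := by
      have : 1 / (1 + ε) ≤ 1 := by rw [div_le_one hp]; linarith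
      linarith
    refine (measure_ge_le_exp_mul_mgf (X := fun X : Fin μ → ℝ => ∑ j, X j ^ 2) _ ht
      (csc_sum_integrable μ hp)).trans ?_
    rw [csc_mgf μ hp, csc_combine μ hp, Real.exp_le_exp]
    nlinarith [mul_le_mul_of_nonneg_left (csc_log_add h0) hn.le]
  have hL : P.real {X | ∑ j : Fin μ, (X j) ^ 2 ≤ (μ : ℝ) * (1 - ε)} ≤
      Real.exp (-(ε ^ 2 - ε ^ 3) * μ / 4) := by
    have ht : (1 - 1 / (1 - ε)) / 2 ≤ 0 := by
      have : 1 ≤ 1 / (1 - ε) := by rw [le_div_iff₀ hm]; linarith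
      linarith
    refine (measure_le_le_exp_mul_mgf (X := fun X : Fin μ → ℝ => ∑ j, X j ^ 2) _ ht
      (csc_sum_integrable μ hm)).trans ?_
    rw [csc_mgf μ hm, csc_combine μ hm, Real.exp_le_exp]
    have h3 : 0 ≤ (μ : ℝ) * ε ^ 3 := by positivity
    nlinarith [mul_le_mul_of_nonneg_left (csc_log_sub h0 h1) hn.le]
  rw [ENNReal.le_ofReal_iff_toReal_le (measure_ne_top _ _) (by positivity)]
  have h2 := measureReal_mono (μ := P) hsub
  have h3 := measureReal_union_le (μ := P) {X | (μ : ℝ) * (1 + ε) ≤ ∑ j : Fin μ, (X j) ^ 2}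
      {X | ∑ j : Fin μ, (X j) ^ 2 ≤ (μ : ℝ) * (1 - ε)}
  change P.real _ ≤ _
  linarith
end
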